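/- arXiv:2407.07130 — 3 statements merged into one kernel-verified Lean document; each statement's English description precedes it below -/
import Mathlib

section
/- For every φ ∈ (0, π/2), define η₃(t) = −4·sin(φ)·(1 − t²)/(t⁴ + 2cos(2φ)t² + 1) and η₁(t) = −4i·sin(2φ)·t/(t⁴ + 2cos(2φ)t² + 1) for t ∈ ℝ. Then the iterated integral ∫₀¹ ( ∫₀ˢ η₃(u) du ) · η₁(s) ds equals −2πi·log(cos φ). -/
open Real intervalIntegral

theorem quad_pos {a : ℝ} (ha : 0 < cos a) (s : ℝ) : 0 < 1 + s ^ 2 + 2 * sin a * s := by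
  nlinarith [sq_nonneg (s + sin a), sin_sq_add_cos_sq a, pow_pos ha 2]

theorem quad_pos' {a : ℝ} (ha : 0 < cos a) (s : ℝ) : 0 < 1 + s ^ 2 - 2 * sin a * s := by
  nlinarith [sq_nonneg (s - sin a), sin_sq_add_cos_sq a, pow_pos ha 2]

theorem quartic_eq_mul (a s : ℝ) :
    s ^ 4 + 2 * cos (2 * a) * s ^ 2 + 1 =
      (1 + s ^ 2 + 2 * sin a * s) * (1 + s ^ 2 - 2 * sin a * s) := by
  rw [cos_two_mul, cos_sq']
  ring

theorem quartic_pos {a : ℝ} (ha : 0 < cos a) (s : ℝ) :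
    0 < s ^ 4 + 2 * cos (2 * a) * s ^ 2 + 1 := by
  rw [quartic_eq_mul]
  exact mul_pos (quad_pos ha s) (quad_pos' ha s)

theorem cos_pos_of_mem_uIcc {a b : ℝ} (ha : |a| < π / 2) (hb : b ∈ Set.uIcc 0 a) : 0 < cos b := by
  obtain ⟨h1, h2⟩ := abs_lt.1 ha
  rcases Set.mem_uIcc.1 hb with h | h <;>
    exact cos_pos_of_mem_Ioo ⟨by linarith [pi_pos], by linarith [pi_pos]⟩

theorem integral_one_sub_sq_div_quartic {a : ℝ} (ha : 0 < cos a) (s : ℝ) :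
    ∫ u in (0:ℝ)..s, -4 * sin a * (1 - u ^ 2) / (u ^ 4 + 2 * cos (2 * a) * u ^ 2 + 1) =
      -(log (1 + s ^ 2 + 2 * sin a * s) - log (1 + s ^ 2 - 2 * sin a * s)) := by
  have hd : ∀ u : ℝ, HasDerivAt
      (fun u => -(log (1 + u ^ 2 + 2 * sin a * u) - log (1 + u ^ 2 - 2 * sin a * u)))
      (-4 * sin a * (1 - u ^ 2) / (u ^ 4 + 2 * cos (2 * a) * u ^ 2 + 1)) u := by
    intro u
    have hp := (quad_pos ha u).ne'
    have hq := (quad_pos' ha u).ne'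
    have hs : HasDerivAt (fun u : ℝ => 1 + u ^ 2) (2 * u) u := by
      simpa using (hasDerivAt_pow 2 u).const_add 1
    have hl : HasDerivAt (fun u : ℝ => 2 * sin a * u) (2 * sin a) u := by
      simpa using (hasDerivAt_id u).const_mul (2 * sin a)
    refine (((hs.fun_add hl).log hp).fun_sub ((hs.fun_sub hl).log hq)).fun_neg.congr_deriv ?_
    rw [quartic_eq_mul, div_sub_div _ _ hp hq, ← neg_div]
    ring
  rw [integral_eq_sub_of_hasDerivAt (fun u _ => hd u)]
  · simp
  · refine Continuous.intervalIntegrable ?_ _ _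
    exact Continuous.div (by fun_prop) (by fun_prop) fun u => (quartic_pos ha u).ne'

theorem log_quad_sub_log_quad_eq_integral {a : ℝ} (ha : |a| < π / 2) (s : ℝ) :
    log (1 + s ^ 2 + 2 * sin a * s) - log (1 + s ^ 2 - 2 * sin a * s) =
      ∫ b in (0:ℝ)..a, 4 * s * cos b * (1 + s ^ 2) / (s ^ 4 + 2 * cos (2 * b) * s ^ 2 + 1) := by
  rw [integral_eq_sub_of_hasDerivAt
    (f := fun b => log (1 + s ^ 2 + 2 * sin b * s) - log (1 + s ^ 2 - 2 * sin b * s))]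
  · simp
  · intro b hb
    have hc := cos_pos_of_mem_uIcc ha hb
    have hp := (quad_pos hc s).ne'
    have hq := (quad_pos' hc s).ne'
    have hl : HasDerivAt (fun b : ℝ => 2 * sin b * s) (2 * cos b * s) b :=
      ((hasDerivAt_sin b).const_mul 2).mul_const s
    refine (((hl.const_add (1 + s ^ 2)).log hp).fun_sub
      ((hl.const_sub (1 + s ^ 2)).log hq)).congr_deriv ?_
    rw [quartic_eq_mul, div_sub_div _ _ hp hq]
    ring
  · refine ContinuousOn.intervalIntegrable ?_
    exact ContinuousOn.div (by fun_prop) (by fun_prop)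
      fun b hb => (quartic_pos (cos_pos_of_mem_uIcc ha hb) s).ne'

theorem integral_one_add_sq_div_quartic {a : ℝ} (ha : 0 < cos a) :
    ∫ s in (0:ℝ)..1, (1 + s ^ 2) / (s ^ 4 + 2 * cos (2 * a) * s ^ 2 + 1) = π / (4 * cos a) := by
  have hd : ∀ s : ℝ, HasDerivAt
      (fun s => (arctan ((s + sin a) / cos a) + arctan ((s - sin a) / cos a)) / (2 * cos a))
      ((1 + s ^ 2) / (s ^ 4 + 2 * cos (2 * a) * s ^ 2 + 1)) s := by
    intro s
    have hp := (quad_pos ha s).ne'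
    have hq := (quad_pos' ha s).ne'
    refine ((((((hasDerivAt_id' s).add_const (sin a)).div_const (cos a)).arctan).fun_add
      ((((hasDerivAt_id' s).sub_const (sin a)).div_const (cos a)).arctan)).div_const
      (2 * cos a)).congr_deriv ?_
    have e1 : 1 + ((s + sin a) / cos a) ^ 2 = (1 + s ^ 2 + 2 * sin a * s) / cos a ^ 2 := by
      field_simp
      linear_combination sin_sq_add_cos_sq a
    have e2 : 1 + ((s - sin a) / cos a) ^ 2 = (1 + s ^ 2 - 2 * sin a * s) / cos a ^ 2 := by
      field_simp
      linear_combination sin_sq_add_cos_sq a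
    have e3 : 1 + s ^ 2 = ((1 + s ^ 2 + 2 * sin a * s) + (1 + s ^ 2 - 2 * sin a * s)) / 2 := by
      ring
    rw [e1, e2, quartic_eq_mul]
    generalize 1 + s ^ 2 + 2 * sin a * s = p at *
    generalize 1 + s ^ 2 - 2 * sin a * s = q at *
    rw [e3]
    field_simp
    ring
  rw [integral_eq_sub_of_hasDerivAt (fun u _ => hd u)]
  · have hs : 0 < 1 + sin a := by nlinarith [sin_sq_add_cos_sq a, neg_one_le_sin a, pow_pos ha 2]
    have e : (1 - sin a) / cos a = ((1 + sin a) / cos a)⁻¹ := by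
      field_simp
      linear_combination -sin_sq_add_cos_sq a
    rw [e, arctan_inv_of_pos (by positivity)]
    simp only [zero_add, zero_sub, neg_div, arctan_neg]
    field_simp
    ring
  · refine Continuous.intervalIntegrable ?_ _ _
    exact Continuous.div (by fun_prop) (by fun_prop) fun u => (quartic_pos ha u).ne'

theorem integral_sin_div_cos_add_cos {a : ℝ} (ha : |a| < π / 2) :
    ∫ b in (0:ℝ)..a, sin a / (cos b + cos a) = -log (cos a) := by
  have h : ∀ b ∈ Set.uIcc 0 a, 0 < cos ((a - b) / 2) ∧ 0 < cos ((a + b) / 2) := by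
    intro b hb
    obtain ⟨h1, h2⟩ := abs_lt.1 ha
    rcases Set.mem_uIcc.1 hb with h | h <;> constructor <;>
      exact cos_pos_of_mem_Ioo ⟨by linarith [pi_pos], by linarith [pi_pos]⟩
  have hsum (b : ℝ) : cos b + cos a = 2 * (cos ((a - b) / 2) * cos ((a + b) / 2)) := by
    rw [add_comm, cos_add_cos]; ring
  rw [integral_eq_sub_of_hasDerivAt
    (f := fun b => log (cos ((a - b) / 2)) - log (cos ((a + b) / 2)))]
  · simp
  · intro b hb
    obtain ⟨hp, hq⟩ := h b hb
    refine ((((((hasDerivAt_id' b).const_sub a).div_const 2).cos).log hp.ne').fun_sub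
      (((((hasDerivAt_id' b).const_add a).div_const 2).cos).log hq.ne')).congr_deriv ?_
    have hsin : sin a = sin ((a - b) / 2) * cos ((a + b) / 2)
        + cos ((a - b) / 2) * sin ((a + b) / 2) := by
      rw [← sin_add]; ring_nf
    rw [hsum, hsin]
    field_simp
    ring
  · refine ContinuousOn.intervalIntegrable ?_
    refine ContinuousOn.div (by fun_prop) (by fun_prop) fun b hb => ?_
    obtain ⟨hp, hq⟩ := h b hb
    rw [hsum]
    positivity

theorem integral_log_quad_sub_log_quad_mul {a : ℝ} (h0 : 0 < a) (h1 : a < π / 2) :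
    ∫ s in (0:ℝ)..1, (log (1 + s ^ 2 + 2 * sin a * s) - log (1 + s ^ 2 - 2 * sin a * s)) *
      (4 * sin (2 * a) * s / (s ^ 4 + 2 * cos (2 * a) * s ^ 2 + 1)) =
      -(2 * π * log (cos a)) := by
  have ha : |a| < π / 2 := by rwa [abs_of_pos h0]
  have hca : 0 < cos a := cos_pos_of_mem_uIcc ha Set.right_mem_uIcc
  have hsa : 0 < sin a := sin_pos_of_pos_of_lt_pi h0 (by linarith)
  calc
    _ = ∫ s in (0:ℝ)..1, ∫ b in (0:ℝ)..a,
          4 * s * cos b * (1 + s ^ 2) / (s ^ 4 + 2 * cos (2 * b) * s ^ 2 + 1) *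
          (4 * sin (2 * a) * s / (s ^ 4 + 2 * cos (2 * a) * s ^ 2 + 1)) := by
      simp only [log_quad_sub_log_quad_eq_integral ha, integral_mul_const]
    _ = ∫ b in (0:ℝ)..a, ∫ s in (0:ℝ)..1,
          4 * s * cos b * (1 + s ^ 2) / (s ^ 4 + 2 * cos (2 * b) * s ^ 2 + 1) *
          (4 * sin (2 * a) * s / (s ^ 4 + 2 * cos (2 * a) * s ^ 2 + 1)) := by
      refine MeasureTheory.intervalIntegral_intervalIntegral_swap ?_
      have hc : ContinuousOn (Function.uncurry fun s b : ℝ =>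
          4 * s * cos b * (1 + s ^ 2) / (s ^ 4 + 2 * cos (2 * b) * s ^ 2 + 1) *
          (4 * sin (2 * a) * s / (s ^ 4 + 2 * cos (2 * a) * s ^ 2 + 1)))
          (Set.uIcc 0 1 ×ˢ Set.uIcc 0 a) := by
        simp only [Function.uncurry_def]
        refine (ContinuousOn.div (by fun_prop) (by fun_prop) ?_).mul
          (ContinuousOn.div (by fun_prop) (by fun_prop) ?_)
        · exact fun p hp => (quartic_pos (cos_pos_of_mem_uIcc ha hp.2) p.1).ne'
        · exact fun p _ => (quartic_pos hca p.1).ne'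
      exact (hc.integrableOn_compact (isCompact_uIcc.prod isCompact_uIcc)).mono_set
        (Set.prod_mono Set.uIoc_subset_uIcc Set.uIoc_subset_uIcc)
    _ = ∫ b in (0:ℝ)..a, 2 * π * (sin a / (cos b + cos a)) := by
      refine integral_congr_Ioo_of_le h0.le fun b hb => ?_
      have hcb : 0 < cos b :=
        cos_pos_of_mem_uIcc ha (by rw [Set.uIcc_of_le h0.le]; exact Set.Ioo_subset_Icc_self hb)
      have hlt : cos a < cos b := cos_lt_cos_of_nonneg_of_le_pi hb.1.le (by linarith) hb.2
      have hsplit : ∀ s : ℝ,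
          4 * s * cos b * (1 + s ^ 2) / (s ^ 4 + 2 * cos (2 * b) * s ^ 2 + 1) *
          (4 * sin (2 * a) * s / (s ^ 4 + 2 * cos (2 * a) * s ^ 2 + 1)) =
          4 * cos b * sin (2 * a) / (cos b ^ 2 - cos a ^ 2) *
          ((1 + s ^ 2) / (s ^ 4 + 2 * cos (2 * a) * s ^ 2 + 1) -
            (1 + s ^ 2) / (s ^ 4 + 2 * cos (2 * b) * s ^ 2 + 1)) := by
        intro s
        have hqa := (quartic_pos hca s).ne'
        have hqb := (quartic_pos hcb s).ne'
        have hne : cos b ^ 2 - cos a ^ 2 ≠ 0 := by nlinarith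
        rw [div_sub_div _ _ hqa hqb, div_mul_div_comm, div_mul_div_comm,
          div_eq_div_iff (by positivity) (by positivity), cos_two_mul, cos_two_mul]
        ring
      have hint : ∀ {c : ℝ}, 0 < cos c → IntervalIntegrable
          (fun s : ℝ => (1 + s ^ 2) / (s ^ 4 + 2 * cos (2 * c) * s ^ 2 + 1))
          MeasureTheory.volume 0 1 := fun hc =>
        (Continuous.div (by fun_prop) (by fun_prop)
          fun u => (quartic_pos hc u).ne').intervalIntegrable _ _
      have hne : cos b - cos a ≠ 0 := (sub_pos.2 hlt).ne'
      simp only [hsplit]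
      rw [intervalIntegral.integral_const_mul, integral_sub (hint hca) (hint hcb),
        integral_one_add_sq_div_quartic hca, integral_one_add_sq_div_quartic hcb, sin_two_mul,
        sq_sub_sq]
      field_simp
    _ = -(2 * π * log (cos a)) := by
      rw [intervalIntegral.integral_const_mul, integral_sin_div_cos_add_cos ha]
      ring

theorem omega31_at_i_depth_two_iterated_integral
    (φ : ℝ) (h0 : 0 < φ) (h1 : φ < Real.pi / 2) :
    (∫ s in (0:ℝ)..1,
        (∫ u in (0:ℝ)..s,
          ((-4 * Real.sin φ * (1 - u ^ 2) / (u ^ 4 + 2 * Real.cos (2 * φ) * u ^ 2 + 1) : ℝ) : ℂ))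
        * (-4 * Complex.I * (Real.sin (2 * φ) : ℂ) * (s : ℂ)
            / ((s : ℂ) ^ 4 + 2 * (Real.cos (2 * φ) : ℂ) * (s : ℂ) ^ 2 + 1)))
      = -(2 * (Real.pi : ℂ) * Complex.I * (Real.log (Real.cos φ) : ℂ)) := by
  have hc : 0 < cos φ := cos_pos_of_mem_Ioo ⟨by linarith, h1⟩
  have hs : ∀ s : ℝ,
      (∫ u in (0:ℝ)..s,
          ((-4 * Real.sin φ * (1 - u ^ 2) / (u ^ 4 + 2 * Real.cos (2 * φ) * u ^ 2 + 1) : ℝ) : ℂ))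
        * (-4 * Complex.I * (Real.sin (2 * φ) : ℂ) * (s : ℂ)
            / ((s : ℂ) ^ 4 + 2 * (Real.cos (2 * φ) : ℂ) * (s : ℂ) ^ 2 + 1)) =
      Complex.I * (((log (1 + s ^ 2 + 2 * sin φ * s) - log (1 + s ^ 2 - 2 * sin φ * s)) *
        (4 * sin (2 * φ) * s / (s ^ 4 + 2 * cos (2 * φ) * s ^ 2 + 1)) : ℝ) : ℂ) := by
    intro s
    rw [intervalIntegral.integral_ofReal, integral_one_sub_sq_div_quartic hc]
    push_cast
    ring
  simp only [hs]
  rw [intervalIntegral.integral_const_mul, intervalIntegral.integral_ofReal,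
    integral_log_quad_sub_log_quad_mul h0 h1]
  push_cast
  ring
end

section
/- Set ω₁(t) = 4i·t/(t⁴+1), ω₂(t) = 2√2·(t²−1)/(t⁴+1), ω₃(t) = 2√2·i·(t²+1)/(t⁴+1) for t ∈ ℝ, and for indices i₁,…,i_n ∈ {1,2,3} let Ω_{i₁,…,i_n} = ∫_{0<t₁<⋯<t_n<1} ω_{i₁}(t₁)⋯ω_{i_n}(t_n) dt₁⋯dt_n denote the iterated integral over the simplex 0 < t₁ < ⋯ < t_n < 1. Then: Ω₃ = iπ; Ω_{2,1} = −iπ·log 2; Ω_{3,1,1} = (iπ/2)·log²2 − iπ³/12; Ω_{2,2,3} = iπ³/12; and Ω_{3,3,3} = −iπ³/6. -/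
/-- The 1-form `ω₁(t) = 4 i t / (t⁴ + 1)` (angle `φ = π/4`). -/
noncomputable def lawsonOmegaForm1 : ℝ → ℂ :=
  fun t => 4 * Complex.I * (t : ℂ) / ((t : ℂ) ^ 4 + 1)

/-- The 1-form `ω₂(t) = 2√2 (t² − 1) / (t⁴ + 1)` (angle `φ = π/4`). -/
noncomputable def lawsonOmegaForm2 : ℝ → ℂ :=
  fun t => ((2 * Real.sqrt 2 * (t ^ 2 - 1) / (t ^ 4 + 1) : ℝ) : ℂ)

/-- The 1-form `ω₃(t) = 2√2 i (t² + 1) / (t⁴ + 1)` (angle `φ = π/4`). -/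
noncomputable def lawsonOmegaForm3 : ℝ → ℂ :=
  fun t => ((2 * Real.sqrt 2 * (t ^ 2 + 1) / (t ^ 4 + 1) : ℝ) : ℂ) * Complex.I

/-- Iterated integral from `0` to `s` of a list of integrands, with the *head* of the
list being the outermost (last) 1-form:
`iterIntAux [] s = 1` and `iterIntAux (f :: fs) s = ∫ t in 0..s, iterIntAux fs t * f t`. -/
noncomputable def iterIntAux : List (ℝ → ℂ) → ℝ → ℂ
  | [], _ => 1
  | f :: fs, s => ∫ t in (0:ℝ)..s, iterIntAux fs t * f t

/-- The iterated integral `Ω_{i₁,…,i_n} = ∫_{0<t₁<⋯<t_n<1} ω_{i₁}(t₁)⋯ω_{i_n}(t_n) dt₁⋯dt_n`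
where the list is given in the order `[ω_{i₁}, …, ω_{i_n}]` (innermost first). -/
noncomputable def OmegaValue (l : List (ℝ → ℂ)) : ℂ := iterIntAux l.reverse 1

open MeasureTheory intervalIntegral

/-- Differentiation under the integral sign over a compact interval, for a jointly continuous
derivative. -/
theorem hasDerivAt_intervalIntegral_of_continuous {f f' : ℝ → ℝ → ℝ} {u v : ℝ}
    (hf : ∀ a, Continuous (f a)) (hf' : Continuous fun p : ℝ × ℝ => f' p.1 p.2)
    (hd : ∀ a x, HasDerivAt (fun b => f b x) (f' a x) a) (a : ℝ) :
    HasDerivAt (fun b => ∫ x in u..v, f b x) (∫ x in u..v, f' a x) a := by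
  obtain ⟨C, hC⟩ := ((isCompact_closedBall a 1).prod
    (isCompact_uIcc (a := u) (b := v))).exists_bound_of_continuousOn hf'.continuousOn
  refine (hasDerivAt_integral_of_dominated_loc_of_deriv_le (bound := fun _ => C)
    (Metric.closedBall_mem_nhds a one_pos) ?_ ((hf a).intervalIntegrable _ _) ?_ ?_ ?_ ?_).2
  · exact Filter.Eventually.of_forall fun b => (hf b).aestronglyMeasurable
  · exact Continuous.aestronglyMeasurable (by fun_prop)
  · exact Filter.Eventually.of_forall fun t ht b hb =>
      hC (b, t) ⟨hb, Set.uIoc_subset_uIcc ht⟩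
  · exact intervalIntegrable_const
  · exact Filter.Eventually.of_forall fun t _ b _ => hd b t

section ParametricIntegrals

open Real

@[fun_prop]
theorem continuous_arsinh_comp {X : Type*} [TopologicalSpace X] {f : X → ℝ} (hf : Continuous f) :
    Continuous fun x => arsinh (f x) :=
  continuous_arsinh.comp hf

theorem hasDerivAt_arsinh_div_sqrt (x : ℝ) :
    HasDerivAt (fun y => arsinh y / √(1 + y ^ 2))
      ((1 - x * (arsinh x / √(1 + x ^ 2))) / (1 + x ^ 2)) x := by
  have h0 : (0 : ℝ) < 1 + x ^ 2 := by positivity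
  have h1 := ((hasDerivAt_pow 2 x).const_add 1).sqrt h0.ne'
  have hs := Real.sqrt_pos.2 h0
  have hq := Real.sq_sqrt h0.le
  refine ((hasDerivAt_arsinh x).div h1 hs.ne').congr_deriv ?_
  rw [hq]
  field_simp
  push_cast
  ring

theorem hasDerivAt_sin_mul_arsinh_div_sqrt (a θ : ℝ) :
    HasDerivAt (fun t => sin t * (arsinh (a * cos t) / √(1 + (a * cos t) ^ 2)))
      (cos θ * (arsinh (a * cos θ) / √(1 + (a * cos θ) ^ 2)) + sin θ *
        ((1 - a * cos θ * (arsinh (a * cos θ) / √(1 + (a * cos θ) ^ 2))) /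
          (1 + (a * cos θ) ^ 2) * (a * -sin θ))) θ :=
  (hasDerivAt_sin θ).mul <| HasDerivAt.comp (h₂ := fun y => arsinh y / √(1 + y ^ 2)) θ
    (hasDerivAt_arsinh_div_sqrt (a * cos θ)) ((hasDerivAt_cos θ).const_mul a)

theorem integral_arsinh_mul_cos_mul (a : ℝ) :
    ∫ θ in (0 : ℝ)..π / 2, a * cos θ * (arsinh (a * cos θ) / √(1 + (a * cos θ) ^ 2))
      = π / 4 * log (1 + a ^ 2) := by
  set W : ℝ → ℝ := fun a =>
    ∫ θ in (0 : ℝ)..π / 2, a * cos θ * (arsinh (a * cos θ) / √(1 + (a * cos θ) ^ 2)) with hW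
  have hpos (x : ℝ) : 1 + x ^ 2 ≠ 0 := by positivity
  set g : ℝ → ℝ → ℝ := fun b θ => cos θ * (arsinh (b * cos θ) / √(1 + (b * cos θ) ^ 2)) +
      b * cos θ * ((1 - b * cos θ * (arsinh (b * cos θ) / √(1 + (b * cos θ) ^ 2))) /
        (1 + (b * cos θ) ^ 2) * cos θ) with hg
  have hgc : Continuous fun p : ℝ × ℝ => g p.1 p.2 := by
    simp only [hg]
    fun_prop (disch := intros; positivity)
  have hderiv (b : ℝ) : HasDerivAt W (∫ θ in (0 : ℝ)..π / 2, g b θ) b := by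
    refine hasDerivAt_intervalIntegral_of_continuous (f := fun b θ =>
      b * cos θ * (arsinh (b * cos θ) / √(1 + (b * cos θ) ^ 2))) (fun a => ?_) hgc (fun a θ => ?_) b
    · fun_prop (disch := intros; positivity)
    · have h1 := (hasDerivAt_mul_const (x := a) (cos θ))
      exact h1.mul (HasDerivAt.comp (h₂ := fun y => arsinh y / √(1 + y ^ 2)) a
        (hasDerivAt_arsinh_div_sqrt (a * cos θ)) h1)
  have hval (b : ℝ) : ∫ θ in (0 : ℝ)..π / 2, g b θ = π / 2 * (b / (1 + b ^ 2)) := by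
    have hF (θ : ℝ) : HasDerivAt (fun t => b / (1 + b ^ 2) * t +
        1 / (1 + b ^ 2) * (sin t * (arsinh (b * cos t) / √(1 + (b * cos t) ^ 2)))) (g b θ) θ := by
      refine (((hasDerivAt_id θ).const_mul (b / (1 + b ^ 2))).add
        ((hasDerivAt_sin_mul_arsinh_div_sqrt b θ).const_mul (1 / (1 + b ^ 2)))).congr_deriv ?_
      have h1 := hpos b
      have h2 := hpos (b * cos θ)
      simp only [hg]
      generalize arsinh (b * cos θ) / √(1 + (b * cos θ) ^ 2) = h
      have hs : sin θ ^ 2 = 1 - cos θ ^ 2 := sin_sq θ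
      field_simp
      rw [hs]
      ring
    rw [integral_eq_sub_of_hasDerivAt (fun θ _ => hF θ)
      (Continuous.intervalIntegrable (by simp only [hg]; fun_prop (disch := intros; positivity)) _ _)]
    simp
    ring
  have hlog (b : ℝ) : HasDerivAt (fun b => W b - π / 4 * log (1 + b ^ 2)) 0 b := by
    refine ((hderiv b).sub ((((hasDerivAt_pow 2 b).const_add 1).log (hpos b)).const_mul
      (π / 4))).congr_deriv ?_
    rw [hval]
    push_cast
    ring
  have hconst := is_const_of_deriv_eq_zero (fun b => (hlog b).differentiableAt)
    (fun b => (hlog b).deriv) a 0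
  simp [hW] at hconst
  linarith

theorem hasDerivAt_integral_arsinh_sq (a : ℝ) :
    HasDerivAt (fun a => ∫ θ in (0 : ℝ)..π / 2, arsinh (a * cos θ) ^ 2)
      (2 * ∫ θ in (0 : ℝ)..π / 2, cos θ * (arsinh (a * cos θ) / √(1 + (a * cos θ) ^ 2))) a := by
  rw [← intervalIntegral.integral_const_mul]
  refine hasDerivAt_intervalIntegral_of_continuous
    (f' := fun a θ => 2 * (cos θ * (arsinh (a * cos θ) / √(1 + (a * cos θ) ^ 2))))
    (fun a => (continuous_arsinh.comp (by fun_prop)).pow 2)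
    (by fun_prop (disch := intros; positivity)) (fun a θ => ?_) a
  refine ((hasDerivAt_mul_const (x := a) (cos θ)).arsinh.pow 2).congr_deriv ?_
  simp
  ring

theorem mul_integral_arsinh (a : ℝ) :
    a * ∫ θ in (0 : ℝ)..π / 2, cos θ * (arsinh (a * cos θ) / √(1 + (a * cos θ) ^ 2))
      = π / 4 * log (1 + a ^ 2) := by
  rw [← integral_arsinh_mul_cos_mul, ← intervalIntegral.integral_const_mul]
  simp only [mul_assoc]

theorem hasDerivAt_arctan_div_sqrt_angle (a θ : ℝ) :
    HasDerivAt (fun t => arctan (a * sin t / √(1 + (a * cos t) ^ 2)))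
      (a * cos θ / √(1 + (a * cos θ) ^ 2)) θ := by
  have h0 : (0 : ℝ) < 1 + (a * cos θ) ^ 2 := by positivity
  have h1 := ((((hasDerivAt_cos θ).const_mul a).pow 2).const_add 1).sqrt h0.ne'
  have hs := Real.sqrt_pos.2 h0
  have hq := Real.sq_sqrt h0.le
  refine (((hasDerivAt_sin θ).const_mul a).div h1 hs.ne').arctan.congr_deriv ?_
  have h3 : (0 : ℝ) < 1 + a ^ 2 := by positivity
  have h4 : 1 + (a * sin θ / √(1 + (a * cos θ) ^ 2)) ^ 2 = (1 + a ^ 2) / (1 + (a * cos θ) ^ 2) := by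
    rw [div_pow, hq]
    field_simp
    linear_combination a ^ 2 * sin_sq_add_cos_sq θ
  simp only [Pi.div_apply, Pi.pow_apply]
  rw [h4, hq]
  simp only [mul_pow] at hq ⊢
  field_simp
  rw [hq, sin_sq]
  push_cast
  ring

theorem hasDerivAt_arctan_div_sqrt_param (a θ : ℝ) :
    HasDerivAt (fun b => arctan (b * sin θ / √(1 + (b * cos θ) ^ 2)))
      (sin θ / ((1 + a ^ 2) * √(1 + (a * cos θ) ^ 2))) a := by
  have h0 : (0 : ℝ) < 1 + (a * cos θ) ^ 2 := by positivity
  have h1 := (((hasDerivAt_mul_const (x := a) (cos θ)).pow 2).const_add 1).sqrt h0.ne'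
  have hs := Real.sqrt_pos.2 h0
  have hq := Real.sq_sqrt h0.le
  refine ((hasDerivAt_mul_const (x := a) (sin θ)).div h1 hs.ne').arctan.congr_deriv ?_
  have h3 : (0 : ℝ) < 1 + a ^ 2 := by positivity
  have h4 : 1 + (a * sin θ / √(1 + (a * cos θ) ^ 2)) ^ 2 = (1 + a ^ 2) / (1 + (a * cos θ) ^ 2) := by
    rw [div_pow, hq]
    field_simp
    linear_combination a ^ 2 * sin_sq_add_cos_sq θ
  simp only [Pi.div_apply, Pi.pow_apply]
  rw [h4, hq]
  simp only [mul_pow] at hq ⊢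
  field_simp
  rw [hq]
  push_cast
  ring

theorem mul_integral_arctan (a : ℝ) :
    a * ∫ θ in (0 : ℝ)..π / 2, arctan (a * sin θ / √(1 + (a * cos θ) ^ 2)) *
        (sin θ / √(1 + (a * cos θ) ^ 2)) = π / 4 * log (1 + a ^ 2) := by
  have hv (θ : ℝ) : HasDerivAt (fun t => -arsinh (a * cos t))
      (a * (sin θ / √(1 + (a * cos θ) ^ 2))) θ := by
    refine ((hasDerivAt_cos θ).const_mul a).arsinh.neg.congr_deriv ?_
    simp
    ring
  have key := integral_mul_deriv_eq_deriv_mul (a := 0) (b := π / 2)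
    (fun θ _ => hasDerivAt_arctan_div_sqrt_angle a θ) (fun θ _ => hv θ)
    (Continuous.intervalIntegrable (by fun_prop (disch := intros; positivity)) _ _)
    (Continuous.intervalIntegrable (by fun_prop (disch := intros; positivity)) _ _)
  rw [← integral_arsinh_mul_cos_mul, ← intervalIntegral.integral_const_mul]
  calc _ = _ := integral_congr fun θ _ => by ring
    _ = _ := key
    _ = _ := by
      simp only [cos_pi_div_two, sin_zero, mul_zero, arsinh_zero, neg_zero, zero_div, arctan_zero,
        zero_mul, sub_zero, zero_sub, ← intervalIntegral.integral_neg]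
      exact integral_congr fun θ _ => by ring

theorem hasDerivAt_integral_arctan_sq (a : ℝ) :
    HasDerivAt (fun a => ∫ θ in (0 : ℝ)..π / 2, arctan (a * sin θ / √(1 + (a * cos θ) ^ 2)) ^ 2)
      (2 / (1 + a ^ 2) * ∫ θ in (0 : ℝ)..π / 2, arctan (a * sin θ / √(1 + (a * cos θ) ^ 2)) *
        (sin θ / √(1 + (a * cos θ) ^ 2))) a := by
  rw [← intervalIntegral.integral_const_mul]
  refine hasDerivAt_intervalIntegral_of_continuous
    (f' := fun a θ => 2 / (1 + a ^ 2) * (arctan (a * sin θ / √(1 + (a * cos θ) ^ 2)) *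
        (sin θ / √(1 + (a * cos θ) ^ 2))))
    (fun a => by fun_prop (disch := intros; positivity))
    (by fun_prop (disch := intros; positivity)) (fun a θ => ?_) a
  refine ((hasDerivAt_arctan_div_sqrt_param a θ).pow 2).congr_deriv ?_
  have h3 : (0 : ℝ) < 1 + a ^ 2 := by positivity
  have h0 : (0 : ℝ) < √(1 + (a * cos θ) ^ 2) := by positivity
  field_simp
  push_cast
  ring

theorem integral_arsinh_sq_sub_integral_arctan_sq (a : ℝ) :
    (∫ θ in (0 : ℝ)..π / 2, arsinh (a * cos θ) ^ 2) -
      (∫ θ in (0 : ℝ)..π / 2, arctan (a * sin θ / √(1 + (a * cos θ) ^ 2)) ^ 2)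
      = π / 8 * log (1 + a ^ 2) ^ 2 := by
  have hD (b : ℝ) := ((hasDerivAt_integral_arsinh_sq b).sub (hasDerivAt_integral_arctan_sq b)).sub
    (((((hasDerivAt_pow 2 b).const_add 1).log
      (by positivity : 1 + b ^ 2 ≠ 0)).pow 2).const_mul (π / 8))
  have hconst := is_const_of_deriv_eq_zero (fun b => (hD b).differentiableAt)
    (fun b => (hD b).deriv.trans ?_) a 0
  · simp at hconst
    linarith
  · rcases eq_or_ne b 0 with rfl | hb
    · simp
    · have h1 := mul_integral_arsinh b
      have h2 := mul_integral_arctan b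
      have h3 : (0 : ℝ) < 1 + b ^ 2 := by positivity
      rw [mul_comm, ← eq_div_iff hb] at h1 h2
      rw [h1, h2]
      field_simp
      push_cast
      ring

theorem hasSum_neg_one_pow_div_succ_sq :
    HasSum (fun n : ℕ => (-1 : ℝ) ^ n / (n + 1) ^ 2) (π ^ 2 / 12) := by
  have h := hasSum_one_div_nat_pow_mul_cos one_ne_zero
    (show (1 / 2 : ℝ) ∈ Set.Icc 0 1 by norm_num)
  have hB : (Polynomial.map (algebraMap ℚ ℝ) (Polynomial.bernoulli (2 * 1))).eval (1 / 2 : ℝ)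
      = -1 / 12 := by
    simp [Polynomial.bernoulli, Finset.sum_range_succ, Nat.choose]
    norm_num
  rw [hB, ← hasSum_nat_add_iff' 1] at h
  convert! h.neg using 1
  · ext n
    have : cos (2 * π * (n + 1 : ℕ) * (1 / 2)) = (-1) ^ (n + 1) := by
      rw [← cos_nat_mul_pi]
      congr 1
      ring
    rw [this]
    push_cast
    ring
  · simp
    ring

theorem integral_arsinh_cos_sq :
    ∫ θ in (0 : ℝ)..π / 2, arsinh (cos θ) ^ 2 = π ^ 3 / 48 := by
  set p : ℝ → ℝ := fun a =>
    2 * ∫ θ in (0 : ℝ)..π / 2, cos θ * (arsinh (a * cos θ) / √(1 + (a * cos θ) ^ 2)) with hp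
  have hpc : Continuous p := by
    refine continuous_const.mul (continuous_parametric_intervalIntegral_of_continuous' ?_ _ _)
    unfold Function.uncurry
    fun_prop (disch := intros; positivity)
  have hFTC := integral_eq_sub_of_hasDerivAt (a := 0) (b := 1)
    (fun a _ => hasDerivAt_integral_arsinh_sq a) (hpc.intervalIntegrable _ _)
  simp only [one_mul, zero_mul, arsinh_zero, ne_eq, OfNat.ofNat_ne_zero, not_false_eq_true,
    zero_pow, intervalIntegral.integral_zero, sub_zero] at hFTC
  rw [← hFTC]
  set F : ℕ → ℝ → ℝ := fun n a => π / 2 * ((-1) ^ n / (n + 1)) * a ^ (2 * n + 1) with hF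
  have hFint (n : ℕ) : ∫ a in (0 : ℝ)..1, F n a = π / 4 * ((-1 : ℝ) ^ n / (n + 1) ^ 2) := by
    simp only [hF, intervalIntegral.integral_const_mul, integral_pow]
    push_cast
    field_simp
    simp
    ring
  have hsum (a : ℝ) (ha : a ∈ Set.Ioo (0 : ℝ) 1) : HasSum (fun n => F n a) (p a) := by
    have hlog := hasSum_pow_div_log_of_abs_lt_one (x := -a ^ 2)
      (by rw [abs_neg, abs_of_nonneg (sq_nonneg a)]; nlinarith [ha.1, ha.2])
    have h1 := mul_integral_arsinh a
    rw [mul_comm, ← eq_div_iff ha.1.ne'] at h1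
    convert! hlog.mul_left (-(π / 2 / a)) using 1
    · ext n
      have := ha.1.ne'
      simp only [hF]
      field_simp
      rw [neg_pow (a ^ 2)]
      ring
    · simp only [hp, h1, sub_neg_eq_add]
      ring
  have hS := hasSum_integral_of_summable_integral_norm (F := F)
    (μ := volume.restrict (Set.Ioc (0 : ℝ) 1)) (fun n => ?_) ?_
  · simp only [← intervalIntegral.integral_of_le zero_le_one, hFint] at hS
    rw [integral_of_le zero_le_one]
    have h2 : ∫ a in Set.Ioc (0 : ℝ) 1, ∑' n, F n a = ∫ a in Set.Ioc (0 : ℝ) 1, p a := by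
      rw [integral_Ioc_eq_integral_Ioo, integral_Ioc_eq_integral_Ioo]
      exact setIntegral_congr_fun measurableSet_Ioo fun a ha => (hsum a ha).tsum_eq
    rw [integral_of_le zero_le_one, h2] at hS
    rw [hS.unique (hasSum_neg_one_pow_div_succ_sq.mul_left (π / 4))]
    ring
  · rw [← IntegrableOn, ← intervalIntegrable_iff_integrableOn_Ioc_of_le zero_le_one]
    exact Continuous.intervalIntegrable (by fun_prop) _ _
  · have habs (n : ℕ) : ∫ a in Set.Ioc (0 : ℝ) 1, ‖F n a‖
        = π / 4 * ‖(-1 : ℝ) ^ n / (n + 1) ^ 2‖ := by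
      have h0 : π / 4 * ‖(-1 : ℝ) ^ n / (n + 1) ^ 2‖ = π / 4 * (1 / (n + 1) ^ 2) := by
        rw [norm_div, norm_pow, norm_neg, norm_one, one_pow, norm_of_nonneg (by positivity)]
      have h1 : ∫ a in Set.Ioc (0 : ℝ) 1, ‖F n a‖ =
          ∫ a in Set.Ioc (0 : ℝ) 1, π / 2 * (1 / (n + 1)) * a ^ (2 * n + 1) := by
        refine setIntegral_congr_fun measurableSet_Ioc fun a ha => ?_
        have := ha.1
        simp only [hF, norm_mul, norm_div, norm_pow, norm_neg, norm_one, one_pow, norm_two]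
        rw [norm_of_nonneg pi_pos.le, norm_of_nonneg this.le, norm_of_nonneg (by positivity)]
      rw [h0, h1, ← integral_of_le zero_le_one, intervalIntegral.integral_const_mul, integral_pow]
      push_cast
      field_simp
      simp
      ring
    simp only [habs]
    exact hasSum_neg_one_pow_div_succ_sq.summable.norm.mul_left _

end ParametricIntegrals

section LawsonAngle

open Real

/-- The angle `θ ∈ [0, π / 2]` with `tan θ = (1 - t ^ 2) / (√2 * t)`, in terms of which
`ω₃ = -2 i dθ`. -/
noncomputable def lawsonAngle (t : ℝ) : ℝ :=
  π / 2 - (arctan (√2 * t + 1) + arctan (√2 * t - 1))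

/-- The real primitive of `ω₂` vanishing at `0`. -/
noncomputable def lawsonLog (t : ℝ) : ℝ :=
  log (t ^ 2 - √2 * t + 1) - log (t ^ 2 + √2 * t + 1)

/-- The primitive of `i * ω₁` vanishing at `1`. -/
noncomputable def lawsonArctan (t : ℝ) : ℝ :=
  2 * arctan ((1 - t ^ 2) / (1 + t ^ 2))

theorem sq_sub_sqrt_two_mul_add_one_pos (t : ℝ) : 0 < t ^ 2 - √2 * t + 1 := by
  nlinarith [sq_nonneg (t - √2 / 2), Real.sq_sqrt (zero_le_two : (0 : ℝ) ≤ 2)]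

theorem sq_add_sqrt_two_mul_add_one_pos (t : ℝ) : 0 < t ^ 2 + √2 * t + 1 := by
  nlinarith [sq_nonneg (t + √2 / 2), Real.sq_sqrt (zero_le_two : (0 : ℝ) ≤ 2)]

theorem pow_four_add_one_eq_mul (t : ℝ) :
    t ^ 4 + 1 = (t ^ 2 - √2 * t + 1) * (t ^ 2 + √2 * t + 1) := by
  linear_combination t ^ 2 * Real.sq_sqrt (zero_le_two : (0 : ℝ) ≤ 2)

theorem hasDerivAt_lawsonAngle (t : ℝ) :
    HasDerivAt lawsonAngle (-(√2 * (t ^ 2 + 1) / (t ^ 4 + 1))) t := by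
  have h := ((hasDerivAt_id t).const_mul √2)
  refine (((h.add_const 1).arctan.add (h.sub_const 1).arctan).const_sub (π / 2)).congr_deriv ?_
  have hm := sq_sub_sqrt_two_mul_add_one_pos t
  have hp := sq_add_sqrt_two_mul_add_one_pos t
  have h2 := Real.sq_sqrt (zero_le_two : (0 : ℝ) ≤ 2)
  have e1 : 1 + (√2 * t + 1) ^ 2 = 2 * (t ^ 2 + √2 * t + 1) := by linear_combination t ^ 2 * h2
  have e2 : 1 + (√2 * t - 1) ^ 2 = 2 * (t ^ 2 - √2 * t + 1) := by linear_combination t ^ 2 * h2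
  simp only [id]
  rw [e1, e2, pow_four_add_one_eq_mul, show t ^ 2 + 1
    = (t ^ 2 + √2 * t + 1 + (t ^ 2 - √2 * t + 1)) / 2 by ring]
  generalize t ^ 2 + √2 * t + 1 = p at *
  generalize t ^ 2 - √2 * t + 1 = q at *
  field_simp
  ring

theorem hasDerivAt_lawsonLog (t : ℝ) :
    HasDerivAt lawsonLog (2 * √2 * (t ^ 2 - 1) / (t ^ 4 + 1)) t := by
  have hm := sq_sub_sqrt_two_mul_add_one_pos t
  have hp := sq_add_sqrt_two_mul_add_one_pos t
  have h := (hasDerivAt_id t).const_mul √2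
  refine (((((hasDerivAt_pow 2 t).sub h).add_const 1).log hm.ne').sub
    ((((hasDerivAt_pow 2 t).add h).add_const 1).log hp.ne')).congr_deriv ?_
  rw [pow_four_add_one_eq_mul]
  refine (div_sub_div _ _ hm.ne' hp.ne').trans ?_
  congr 1
  push_cast
  ring

theorem hasDerivAt_lawsonArctan (t : ℝ) :
    HasDerivAt lawsonArctan (-(4 * t / (t ^ 4 + 1))) t := by
  have h0 : 1 + t ^ 2 ≠ 0 := by positivity
  have h1 : t ^ 4 + 1 ≠ 0 := by positivity
  have h2 : 1 + ((1 - t ^ 2) / (1 + t ^ 2)) ^ 2 = 2 * (t ^ 4 + 1) / (1 + t ^ 2) ^ 2 := by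
    field_simp
    ring
  refine ((((hasDerivAt_pow 2 t).const_sub 1).fun_div
    ((hasDerivAt_pow 2 t).const_add 1) h0).arctan.const_mul 2).congr_deriv ?_
  rw [h2]
  field_simp
  push_cast
  ring

theorem continuous_lawsonAngle : Continuous lawsonAngle :=
  continuous_iff_continuousAt.2 fun t => (hasDerivAt_lawsonAngle t).continuousAt

theorem continuous_lawsonLog : Continuous lawsonLog :=
  continuous_iff_continuousAt.2 fun t => (hasDerivAt_lawsonLog t).continuousAt

theorem continuous_lawsonArctan : Continuous lawsonArctan :=
  continuous_iff_continuousAt.2 fun t => (hasDerivAt_lawsonArctan t).continuousAt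

theorem lawsonAngle_zero : lawsonAngle 0 = π / 2 := by
  simp [lawsonAngle, arctan_neg]

theorem lawsonAngle_one : lawsonAngle 1 = 0 := by
  have h2 := Real.sq_sqrt (zero_le_two : (0 : ℝ) ≤ 2)
  have h : √2 - 1 = (√2 + 1)⁻¹ := by
    exact eq_inv_of_mul_eq_one_left (by linear_combination h2)
  rw [lawsonAngle, mul_one, h, arctan_inv_of_pos (by positivity)]
  ring

theorem lawsonLog_zero : lawsonLog 0 = 0 := by simp [lawsonLog]

theorem lawsonArctan_one : lawsonArctan 1 = 0 := by simp [lawsonArctan]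

theorem sqrt_mul_sqrt_eq_two_mul_sqrt (t : ℝ) :
    √(1 + (√2 * t + 1) ^ 2) * √(1 + (√2 * t - 1) ^ 2) = 2 * √(t ^ 4 + 1) := by
  have h2 := Real.sq_sqrt (zero_le_two : (0 : ℝ) ≤ 2)
  rw [← Real.sqrt_mul (by positivity), show (1 + (√2 * t + 1) ^ 2) * (1 + (√2 * t - 1) ^ 2)
      = 2 ^ 2 * (t ^ 4 + 1) by linear_combination (t ^ 4 * (√2 ^ 2 + 2)) * h2,
    Real.sqrt_mul (by positivity), Real.sqrt_sq zero_le_two]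

theorem cos_lawsonAngle (t : ℝ) : cos (lawsonAngle t) = √2 * t / √(t ^ 4 + 1) := by
  have h := sqrt_mul_sqrt_eq_two_mul_sqrt t
  rw [lawsonAngle, cos_pi_div_two_sub, sin_add, sin_arctan, sin_arctan, cos_arctan, cos_arctan,
    div_mul_div_comm, div_mul_div_comm, h, ← add_div]
  field_simp
  ring

theorem sin_lawsonAngle (t : ℝ) : sin (lawsonAngle t) = (1 - t ^ 2) / √(t ^ 4 + 1) := by
  have h := sqrt_mul_sqrt_eq_two_mul_sqrt t
  have h2 := Real.sq_sqrt (zero_le_two : (0 : ℝ) ≤ 2)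
  rw [lawsonAngle, sin_pi_div_two_sub, cos_add, sin_arctan, sin_arctan, cos_arctan, cos_arctan,
    div_mul_div_comm, div_mul_div_comm, h, ← sub_div]
  field_simp
  linear_combination -t ^ 2 * h2

theorem sqrt_one_add_cos_lawsonAngle_sq (t : ℝ) :
    √(1 + cos (lawsonAngle t) ^ 2) = (1 + t ^ 2) / √(t ^ 4 + 1) := by
  have h2 := Real.sq_sqrt (zero_le_two : (0 : ℝ) ≤ 2)
  have h4 := Real.sq_sqrt (by positivity : (0 : ℝ) ≤ t ^ 4 + 1)
  rw [cos_lawsonAngle, ← Real.sqrt_sq (by positivity : 0 ≤ (1 + t ^ 2) / √(t ^ 4 + 1))]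
  congr 1
  rw [div_pow, div_pow, h4, mul_pow, h2]
  field_simp
  ring

theorem arsinh_cos_lawsonAngle (t : ℝ) : arsinh (cos (lawsonAngle t)) = -(lawsonLog t / 2) := by
  have hm := sq_sub_sqrt_two_mul_add_one_pos t
  have hp := sq_add_sqrt_two_mul_add_one_pos t
  rw [arsinh, sqrt_one_add_cos_lawsonAngle_sq, cos_lawsonAngle, ← add_div,
    show √2 * t + (1 + t ^ 2) = t ^ 2 + √2 * t + 1 by ring, log_div hp.ne' (by positivity),
    Real.log_sqrt (by positivity), pow_four_add_one_eq_mul, log_mul hm.ne' hp.ne', lawsonLog]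
  ring

theorem arctan_sin_lawsonAngle (t : ℝ) :
    arctan (sin (lawsonAngle t) / √(1 + cos (lawsonAngle t) ^ 2)) = lawsonArctan t / 2 := by
  rw [sin_lawsonAngle, sqrt_one_add_cos_lawsonAngle_sq,
    div_div_div_cancel_right₀ (by positivity), lawsonArctan]
  ring

theorem integral_comp_lawsonAngle {g : ℝ → ℝ} (hg : Continuous g) :
    ∫ t in (0 : ℝ)..1, g (lawsonAngle t) * (√2 * (t ^ 2 + 1) / (t ^ 4 + 1))
      = ∫ θ in (0 : ℝ)..π / 2, g θ := by
  have h := integral_comp_mul_deriv (a := 0) (b := 1) (fun t _ => hasDerivAt_lawsonAngle t)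
    (Continuous.continuousOn (by fun_prop (disch := intros; positivity))) hg
  rw [lawsonAngle_zero, lawsonAngle_one, integral_symm 0 (π / 2)] at h
  simp only [Function.comp_def, mul_neg, intervalIntegral.integral_neg] at h
  exact neg_inj.1 h

theorem integral_lawsonLog_sq_mul :
    ∫ t in (0 : ℝ)..1, lawsonLog t ^ 2 * (2 * √2 * (t ^ 2 + 1) / (t ^ 4 + 1)) = π ^ 3 / 6 := by
  have h := integral_comp_lawsonAngle (continuous_arsinh.comp continuous_cos |>.pow 2)
  simp only [Function.comp_apply, Pi.pow_apply, integral_arsinh_cos_sq, arsinh_cos_lawsonAngle] at h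
  calc _ = 8 * ∫ t in (0 : ℝ)..1, (-(lawsonLog t / 2)) ^ 2 *
        (√2 * (t ^ 2 + 1) / (t ^ 4 + 1)) := by
        rw [← intervalIntegral.integral_const_mul]
        exact integral_congr fun t _ => by ring
    _ = _ := by rw [h]; ring

theorem integral_lawsonArctan_sq_mul :
    ∫ t in (0 : ℝ)..1, lawsonArctan t ^ 2 * (2 * √2 * (t ^ 2 + 1) / (t ^ 4 + 1))
      = π ^ 3 / 6 - π * log 2 ^ 2 := by
  have h := integral_comp_lawsonAngle
    (g := fun θ => arctan (sin θ / √(1 + cos θ ^ 2)) ^ 2)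
    (by fun_prop (disch := intros; positivity))
  have h' := integral_arsinh_sq_sub_integral_arctan_sq 1
  simp only [one_mul, one_pow, integral_arsinh_cos_sq, one_add_one_eq_two] at h'
  simp only [arctan_sin_lawsonAngle] at h
  calc _ = 8 * ∫ t in (0 : ℝ)..1, (lawsonArctan t / 2) ^ 2 *
        (√2 * (t ^ 2 + 1) / (t ^ 4 + 1)) := by
        rw [← intervalIntegral.integral_const_mul]
        exact integral_congr fun t _ => by ring
    _ = _ := by rw [h]; linear_combination -8 * h'

theorem integral_lawsonLog_mul :
    ∫ t in (0 : ℝ)..1, lawsonLog t * (4 * t / (t ^ 4 + 1)) = -(π * log 2) := by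
  have h := integral_comp_lawsonAngle
    (g := fun θ => cos θ * (arsinh (cos θ) / √(1 + cos θ ^ 2)))
    (continuous_cos.mul ((continuous_arsinh.comp continuous_cos).div (by fun_prop)
      (fun _ => by positivity)))
  have h' := integral_arsinh_mul_cos_mul 1
  simp only [one_mul, one_pow, one_add_one_eq_two] at h'
  rw [h'] at h
  simp only [arsinh_cos_lawsonAngle, sqrt_one_add_cos_lawsonAngle_sq] at h
  simp only [cos_lawsonAngle] at h
  have h2 := Real.sq_sqrt (zero_le_two : (0 : ℝ) ≤ 2)
  calc _ = -4 * ∫ t in (0 : ℝ)..1, √2 * t / √(t ^ 4 + 1) *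
        (-(lawsonLog t / 2) / ((1 + t ^ 2) / √(t ^ 4 + 1))) *
        (√2 * (t ^ 2 + 1) / (t ^ 4 + 1)) := by
        rw [← intervalIntegral.integral_const_mul]
        refine integral_congr fun t _ => ?_
        have : 0 < √(t ^ 4 + 1) := by positivity
        have : 0 < 1 + t ^ 2 := by positivity
        field_simp
        rw [h2]
        ring
    _ = _ := by rw [h]; ring

theorem integral_omega_three (s : ℝ) :
    ∫ t in (0 : ℝ)..s, 2 * √2 * (t ^ 2 + 1) / (t ^ 4 + 1) = π - 2 * lawsonAngle s := by
  have h (t : ℝ) : HasDerivAt (fun t => π - 2 * lawsonAngle t)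
      (2 * √2 * (t ^ 2 + 1) / (t ^ 4 + 1)) t :=
    (((hasDerivAt_lawsonAngle t).const_mul 2).const_sub π).congr_deriv (by ring)
  rw [integral_eq_sub_of_hasDerivAt (fun t _ => h t)
    (Continuous.intervalIntegrable (by fun_prop (disch := intros; positivity)) _ _),
    lawsonAngle_zero]
  ring

theorem integral_omega_two (s : ℝ) :
    ∫ t in (0 : ℝ)..s, 2 * √2 * (t ^ 2 - 1) / (t ^ 4 + 1) = lawsonLog s := by
  rw [integral_eq_sub_of_hasDerivAt (fun t _ => hasDerivAt_lawsonLog t)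
    (Continuous.intervalIntegrable (by fun_prop (disch := intros; positivity)) _ _),
    lawsonLog_zero, sub_zero]

theorem integral_omega_two_two (s : ℝ) :
    ∫ t in (0 : ℝ)..s, lawsonLog t * (2 * √2 * (t ^ 2 - 1) / (t ^ 4 + 1))
      = lawsonLog s ^ 2 / 2 := by
  have hc := continuous_lawsonLog
  rw [integral_eq_sub_of_hasDerivAt (f := fun t => lawsonLog t ^ 2 / 2)
    (fun t _ => (((hasDerivAt_lawsonLog t).fun_pow 2).div_const 2).congr_deriv (by
      push_cast
      ring))
    (Continuous.intervalIntegrable (by fun_prop (disch := intros; positivity)) _ _),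
    lawsonLog_zero]
  ring

theorem integral_omega_three_pow (n : ℕ) (s : ℝ) :
    ∫ t in (0 : ℝ)..s, (π - 2 * lawsonAngle t) ^ n * (2 * √2 * (t ^ 2 + 1) / (t ^ 4 + 1))
      = (π - 2 * lawsonAngle s) ^ (n + 1) / (n + 1) := by
  have hc := continuous_lawsonAngle
  rw [integral_eq_sub_of_hasDerivAt (f := fun t => (π - 2 * lawsonAngle t) ^ (n + 1) / (n + 1))
    (fun t _ => (((((hasDerivAt_lawsonAngle t).const_mul 2).const_sub π).fun_pow
      (n + 1)).div_const _).congr_deriv (by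
        push_cast
        field_simp))
    (Continuous.intervalIntegrable (by fun_prop (disch := intros; positivity)) _ _),
    lawsonAngle_zero]
  simp [mul_div_cancel₀]

theorem integral_omega_three_one_one :
    ∫ s in (0 : ℝ)..1, (∫ t in (0 : ℝ)..s, (π - 2 * lawsonAngle t) * (4 * t / (t ^ 4 + 1))) *
      (4 * s / (s ^ 4 + 1)) = π ^ 3 / 12 - π / 2 * log 2 ^ 2 := by
  have hA := continuous_lawsonAngle
  have hG := continuous_lawsonArctan
  set X : ℝ → ℝ := fun s => ∫ t in (0 : ℝ)..s, (π - 2 * lawsonAngle t) * (4 * t / (t ^ 4 + 1))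
    with hX
  have hX' (s : ℝ) : HasDerivAt X ((π - 2 * lawsonAngle s) * (4 * s / (s ^ 4 + 1))) s :=
    integral_hasDerivAt_right
      (Continuous.intervalIntegrable (by fun_prop (disch := intros; positivity)) _ _)
      (Continuous.stronglyMeasurableAtFilter (by fun_prop (disch := intros; positivity)) _ _)
      (Continuous.continuousAt (by fun_prop (disch := intros; positivity)))
  have hXc : Continuous X := continuous_iff_continuousAt.2 fun t => (hX' t).continuousAt
  have hder (t : ℝ) : HasDerivAt (fun t => -(X t * lawsonArctan t) -
      (π - 2 * lawsonAngle t) * lawsonArctan t ^ 2 / 2)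
      (X t * (4 * t / (t ^ 4 + 1)) -
        1 / 2 * (lawsonArctan t ^ 2 * (2 * √2 * (t ^ 2 + 1) / (t ^ 4 + 1)))) t := by
    refine (((hX' t).fun_mul (hasDerivAt_lawsonArctan t)).fun_neg.fun_sub
      (((((hasDerivAt_lawsonAngle t).const_mul 2).const_sub π).fun_mul
        ((hasDerivAt_lawsonArctan t).fun_pow 2)).div_const 2)).congr_deriv ?_
    push_cast
    ring
  have h := integral_eq_sub_of_hasDerivAt (a := 0) (b := 1) (fun t _ => hder t)
    (Continuous.intervalIntegrable (by fun_prop (disch := intros; positivity)) _ _)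
  rw [intervalIntegral.integral_sub
    (Continuous.intervalIntegrable (by fun_prop (disch := intros; positivity)) _ _)
    (Continuous.intervalIntegrable (by fun_prop (disch := intros; positivity)) _ _),
    intervalIntegral.integral_const_mul, integral_lawsonArctan_sq_mul, lawsonArctan_one,
    lawsonAngle_zero, show X 0 = 0 by simp [hX]] at h
  linear_combination h

end LawsonAngle

theorem iterIntAux_cons_of_ofReal {l : List (ℝ → ℂ)} {F f : ℝ → ℝ} {ω : ℝ → ℂ} {c d : ℂ}
    (hl : ∀ s, iterIntAux l s = (F s : ℂ) * c) (hω : ∀ t, ω t = (f t : ℂ) * d) (s : ℝ) :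
    iterIntAux (ω :: l) s = ((∫ t in (0 : ℝ)..s, F t * f t : ℝ) : ℂ) * (c * d) := by
  rw [iterIntAux, ← intervalIntegral.integral_ofReal, ← intervalIntegral.integral_mul_const]
  refine integral_congr fun t _ => ?_
  simp only [hl, hω]
  push_cast
  ring

theorem iterIntAux_nil_eq (s : ℝ) : iterIntAux [] s = ((1 : ℝ) : ℂ) * 1 := by
  simp [iterIntAux]

theorem lawsonOmegaForm1_eq (t : ℝ) :
    lawsonOmegaForm1 t = ((4 * t / (t ^ 4 + 1) : ℝ) : ℂ) * Complex.I := by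
  rw [lawsonOmegaForm1]
  push_cast
  ring

theorem lawsonOmegaForm2_eq (t : ℝ) :
    lawsonOmegaForm2 t = ((2 * √2 * (t ^ 2 - 1) / (t ^ 4 + 1) : ℝ) : ℂ) * 1 :=
  (mul_one _).symm

theorem lawsonOmegaForm3_eq (t : ℝ) :
    lawsonOmegaForm3 t = ((2 * √2 * (t ^ 2 + 1) / (t ^ 4 + 1) : ℝ) : ℂ) * Complex.I :=
  rfl

theorem iterIntAux_three (s : ℝ) :
    iterIntAux [lawsonOmegaForm3] s
      = ((Real.pi - 2 * lawsonAngle s : ℝ) : ℂ) * (1 * Complex.I) := by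
  rw [iterIntAux_cons_of_ofReal iterIntAux_nil_eq lawsonOmegaForm3_eq]
  simp only [one_mul, integral_omega_three]

theorem iterIntAux_two (s : ℝ) :
    iterIntAux [lawsonOmegaForm2] s = (lawsonLog s : ℂ) * (1 * 1) := by
  rw [iterIntAux_cons_of_ofReal iterIntAux_nil_eq lawsonOmegaForm2_eq]
  simp only [one_mul, integral_omega_two]

theorem lawson_depth_le_three_omega_values :
    OmegaValue [lawsonOmegaForm3] = (Real.pi : ℂ) * Complex.I ∧
    OmegaValue [lawsonOmegaForm2, lawsonOmegaForm1]
      = -((Real.pi : ℂ) * Complex.I * (Real.log 2 : ℂ)) ∧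
    OmegaValue [lawsonOmegaForm3, lawsonOmegaForm1, lawsonOmegaForm1]
      = (Real.pi : ℂ) * Complex.I / 2 * (Real.log 2 : ℂ) ^ 2
        - (Real.pi : ℂ) ^ 3 * Complex.I / 12 ∧
    OmegaValue [lawsonOmegaForm2, lawsonOmegaForm2, lawsonOmegaForm3]
      = (Real.pi : ℂ) ^ 3 * Complex.I / 12 ∧
    OmegaValue [lawsonOmegaForm3, lawsonOmegaForm3, lawsonOmegaForm3]
      = -((Real.pi : ℂ) ^ 3 * Complex.I / 6) := by
  simp only [OmegaValue, List.reverse_cons, List.reverse_nil, List.nil_append, List.cons_append]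
  refine ⟨?_, ?_, ?_, ?_, ?_⟩
  · rw [iterIntAux_three, lawsonAngle_one]
    simp
  · rw [iterIntAux_cons_of_ofReal iterIntAux_two lawsonOmegaForm1_eq, integral_lawsonLog_mul]
    push_cast
    ring
  · rw [iterIntAux_cons_of_ofReal (iterIntAux_cons_of_ofReal iterIntAux_three lawsonOmegaForm1_eq)
      lawsonOmegaForm1_eq, integral_omega_three_one_one]
    push_cast
    linear_combination ((Real.pi : ℂ) ^ 3 / 12 - Real.pi / 2 * (Real.log 2 : ℂ) ^ 2) *
      Complex.I * Complex.I_sq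
  · rw [iterIntAux_cons_of_ofReal (iterIntAux_cons_of_ofReal iterIntAux_two lawsonOmegaForm2_eq)
      lawsonOmegaForm3_eq]
    simp only [integral_omega_two_two, div_mul_eq_mul_div, intervalIntegral.integral_div,
      integral_lawsonLog_sq_mul]
    push_cast
    ring
  · have h1 (s : ℝ) := integral_omega_three_pow 1 s
    have h2 := integral_omega_three_pow 2 1
    rw [iterIntAux_cons_of_ofReal (iterIntAux_cons_of_ofReal iterIntAux_three lawsonOmegaForm3_eq)
      lawsonOmegaForm3_eq]
    simp only [pow_one] at h1
    simp only [h1, div_mul_eq_mul_div, intervalIntegral.integral_div]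
    norm_num only at h2 ⊢
    rw [h2, lawsonAngle_one]
    push_cast
    linear_combination (Real.pi : ℂ) ^ 3 / 6 * Complex.I * Complex.I_sq
end

section
/- The family (k₁,k₂) ↦ (−1)^{k₁}/(k₁·k₂²), indexed by pairs of positive integers with k₁ < k₂, is absolutely summable, and ∑_{0<k₁<k₂} (−1)^{k₁}/(k₁·k₂²) = ζ(3) − (π²/4)·log 2. (This is the alternating multiple zeta value ζ(1̄,2).) -/
open Filter Topology Finset

/-- Partial sums of the alternating harmonic series. -/
noncomputable def altHarmonic (n : ℕ) : ℝ := ∑ i ∈ range n, (-1 : ℝ) ^ i / ((i : ℝ) + 1)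

lemma altHarmonic_succ (n : ℕ) :
    altHarmonic (n + 1) = altHarmonic n + (-1 : ℝ) ^ n / ((n : ℝ) + 1) :=
  sum_range_succ _ _

lemma tendsto_altHarmonic : Tendsto altHarmonic atTop (𝓝 (Real.log 2)) := by
  obtain ⟨l, h⟩ : ∃ l, Tendsto altHarmonic atTop (𝓝 l) := by
    have := Antitone.tendsto_alternating_series_of_tendsto_zero
      (f := fun i : ℕ => 1 / ((i : ℝ) + 1))
      (antitone_iff_forall_lt.mpr fun _ _ _ => by gcongr)
      tendsto_one_div_add_atTop_nhds_zero_nat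
    simpa [altHarmonic, div_eq_mul_inv] using! this
  have m : 𝓝[<] (1 : ℝ) ≤ 𝓝 1 := nhdsWithin_le_nhds
  have abel := (Real.tendsto_tsum_powerSeries_nhdsWithin_lt h).mul m
  rw [mul_one] at abel
  have hlog : Tendsto (fun x : ℝ => Real.log (1 + x)) (𝓝[<] 1) (𝓝 l) := by
    apply abel.congr'
    filter_upwards [Ioo_mem_nhdsLT (show (-1 : ℝ) < 1 by norm_num)] with x hx
    have hx' : |(-x)| < 1 := by rw [abs_neg, abs_lt]; exact hx
    have hs := (Real.hasSum_pow_div_log_of_abs_lt_one hx').neg.tsum_eq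
    rw [neg_neg, sub_neg_eq_add] at hs
    rw [← hs, ← tsum_mul_right]
    refine tsum_congr fun n => ?_
    rw [neg_pow x, pow_succ, pow_succ]
    ring
  have hc : Tendsto (fun x : ℝ => Real.log (1 + x)) (𝓝[<] 1) (𝓝 (Real.log 2)) := by
    have : ContinuousAt (fun x : ℝ => Real.log (1 + x)) 1 :=
      ContinuousAt.log (by fun_prop) (by norm_num)
    have h2 := this.tendsto.mono_left m
    norm_num at h2
    exact h2
  rwa [tendsto_nhds_unique hlog hc] at h

lemma summable_inv_mul_mul_add :
    Summable fun p : ℕ × ℕ =>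
      1 / (((p.1 : ℝ) + 1) * ((p.2 : ℝ) + 1) * ((p.1 : ℝ) + p.2 + 2)) := by
  have h1 : Summable fun n : ℕ => 1 / ((n : ℝ) + 1) ^ (3 / 2 : ℝ) := by
    have := (summable_nat_add_iff 1).mpr
      (Real.summable_one_div_nat_rpow.mpr (show (1 : ℝ) < 3 / 2 by norm_num))
    simpa using! this
  refine Summable.of_nonneg_of_le (fun p => by positivity) (fun p => ?_)
    (h1.mul_of_nonneg h1 (fun _ => by positivity) (fun _ => by positivity))
  rw [div_mul_div_comm, one_mul]
  have key : ∀ x : ℝ, 0 < x → x ^ (3 / 2 : ℝ) = x * √x := fun x hx => by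
    rw [Real.sqrt_eq_rpow, ← Real.rpow_one_add' hx.le (by norm_num)]
    norm_num
  rw [key _ (by positivity), key _ (by positivity)]
  have ha : (0 : ℝ) < (p.1 : ℝ) + 1 := by positivity
  have hb : (0 : ℝ) < (p.2 : ℝ) + 1 := by positivity
  apply one_div_le_one_div_of_le (by positivity)
  have h3 : √((p.1 : ℝ) + 1) * √((p.2 : ℝ) + 1) ≤ (p.1 : ℝ) + p.2 + 2 := by
    nlinarith [Real.sq_sqrt ha.le, Real.sq_sqrt hb.le,
      sq_nonneg (√((p.1 : ℝ) + 1) - √((p.2 : ℝ) + 1))]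
  calc _ = ((p.1 : ℝ) + 1) * ((p.2 : ℝ) + 1) * (√((p.1 : ℝ) + 1) * √((p.2 : ℝ) + 1)) := by ring
    _ ≤ _ := by gcongr

lemma summable_alternating_mul_mul_add :
    Summable fun p : ℕ × ℕ =>
      (-1 : ℝ) ^ p.2 / (((p.1 : ℝ) + 1) * ((p.2 : ℝ) + 1) * ((p.1 : ℝ) + p.2 + 2)) := by
  refine Summable.of_norm_bounded summable_inv_mul_mul_add fun p => le_of_eq ?_
  rw [norm_div, norm_pow, norm_neg, norm_one, one_pow, Real.norm_of_nonneg (by positivity)]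

lemma summable_inv_mul_add_sq :
    Summable fun p : ℕ × ℕ => 1 / (((p.1 : ℝ) + 1) * ((p.1 : ℝ) + p.2 + 2) ^ 2) := by
  refine Summable.of_nonneg_of_le (fun p => by positivity) (fun p => ?_) summable_inv_mul_mul_add
  rw [pow_two, ← mul_assoc]
  have : (0 : ℝ) ≤ p.1 := by positivity
  gcongr
  · linarith
  · norm_num

lemma summable_alternating_mul_add_sq :
    Summable fun p : ℕ × ℕ =>
      (-1 : ℝ) ^ p.2 / (((p.1 : ℝ) + 1) * ((p.1 : ℝ) + p.2 + 2) ^ 2) := by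
  refine Summable.of_norm_bounded summable_inv_mul_add_sq fun p => le_of_eq ?_
  rw [norm_div, norm_pow, norm_neg, norm_one, one_pow, Real.norm_of_nonneg (by positivity)]

lemma sum_alternating_shift (i N : ℕ) :
    ∑ j ∈ range N, (-1 : ℝ) ^ j / ((i : ℝ) + j + 2) =
      (-1) ^ i * (altHarmonic (i + 1) - altHarmonic (i + 1 + N)) := by
  induction N with
  | zero => simp
  | succ N ih =>
    rw [sum_range_succ, ih, ← add_assoc, altHarmonic_succ (i + 1 + N)]
    have h : (-1 : ℝ) ^ (i + 1 + N) = -((-1) ^ i * (-1) ^ N) := by ring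
    have h2 : (-1 : ℝ) ^ i * (-1) ^ i = 1 := by rw [← mul_pow]; simp
    have h3 : ((i + 1 + N : ℕ) : ℝ) + 1 = (i : ℝ) + N + 2 := by push_cast; ring
    rw [h, h3]
    linear_combination (-(-1 : ℝ) ^ N / ((i : ℝ) + N + 2)) * h2

lemma hasSum_alternating_mul_mul_add_row (i : ℕ) :
    HasSum (fun j : ℕ =>
      (-1 : ℝ) ^ j / (((i : ℝ) + 1) * ((j : ℝ) + 1) * ((i : ℝ) + j + 2)))
      ((Real.log 2 + (-1) ^ i * (Real.log 2 - altHarmonic (i + 1))) / ((i : ℝ) + 1) ^ 2) := by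
  have hs := summable_alternating_mul_mul_add.prod_factor i
  rw [hs.hasSum_iff_tendsto_nat]
  have h1 : ∀ N : ℕ, ∑ j ∈ range N,
      (-1 : ℝ) ^ j / (((i : ℝ) + 1) * ((j : ℝ) + 1) * ((i : ℝ) + j + 2)) =
      (altHarmonic N + (-1) ^ i * (altHarmonic (N + (i + 1)) - altHarmonic (i + 1)))
        / ((i : ℝ) + 1) ^ 2 := fun N => by
    have : altHarmonic N + (-1) ^ i * (altHarmonic (N + (i + 1)) - altHarmonic (i + 1)) =
        ∑ j ∈ range N, ((-1 : ℝ) ^ j / ((j : ℝ) + 1) - (-1 : ℝ) ^ j / ((i : ℝ) + j + 2)) := by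
      rw [sum_sub_distrib, sum_alternating_shift, add_comm N, altHarmonic]
      ring
    rw [this, sum_div]
    refine sum_congr rfl fun j _ => ?_
    have : (i : ℝ) + j + 2 ≠ 0 := by positivity
    field_simp
    ring
  simp_rw [h1]
  exact (tendsto_altHarmonic.add (((tendsto_altHarmonic.comp
    (tendsto_add_atTop_nat (i + 1))).sub_const _).const_mul _)).div_const _

lemma sum_antidiagonal_alternating_mul_add_sq (n : ℕ) :
    ∑ p ∈ antidiagonal n, (-1 : ℝ) ^ p.2 / (((p.1 : ℝ) + 1) * ((p.1 : ℝ) + p.2 + 2) ^ 2) =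
      (-1) ^ n * altHarmonic (n + 1) / ((n : ℝ) + 2) ^ 2 := by
  rw [Nat.sum_antidiagonal_eq_sum_range_succ_mk, altHarmonic, mul_sum, sum_div]
  refine sum_congr rfl fun i hi => ?_
  obtain ⟨j, rfl⟩ := Nat.exists_eq_add_of_le (Nat.lt_succ_iff.mp (mem_range.mp hi))
  have h2 : (-1 : ℝ) ^ i * (-1) ^ i = 1 := by rw [← mul_pow]; simp
  have h3 : (-1 : ℝ) ^ (i + j) * ((-1) ^ i / ((i : ℝ) + 1)) = (-1) ^ j / ((i : ℝ) + 1) := by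
    rw [pow_add]
    linear_combination ((-1 : ℝ) ^ j / ((i : ℝ) + 1)) * h2
  rw [h3]
  simp only [Nat.add_sub_cancel_left]
  push_cast
  rw [div_div]

lemma hasSum_alternating_altHarmonic :
    HasSum (fun i : ℕ => -((-1 : ℝ) ^ i * altHarmonic i / ((i : ℝ) + 1) ^ 2))
      (∑' p : ℕ × ℕ, (-1 : ℝ) ^ p.2 / (((p.1 : ℝ) + 1) * ((p.1 : ℝ) + p.2 + 2) ^ 2)) := by
  have h := (HasAntidiagonal.sigmaAntidiagonalEquivProd (A := ℕ)).hasSum_iff.mpr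
    summable_alternating_mul_add_sq.hasSum
  have h2 := h.sigma fun n => hasSum_fintype _
  rw [← hasSum_nat_add_iff' 1]
  have h0 : altHarmonic 0 = 0 := by simp [altHarmonic]
  simp only [range_one, sum_singleton, h0, mul_zero, zero_div, neg_zero, sub_zero]
  convert! h2 using 2 with n
  refine Eq.trans ?_ (sum_coe_sort (antidiagonal n)
    (fun p : ℕ × ℕ => (-1 : ℝ) ^ p.2 / (((p.1 : ℝ) + 1) * ((p.1 : ℝ) + p.2 + 2) ^ 2))).symm
  rw [sum_antidiagonal_alternating_mul_add_sq]
  push_cast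
  ring

lemma hasSum_one_add_alternating_div_sq :
    HasSum (fun i : ℕ => (1 + (-1 : ℝ) ^ i) / ((i : ℝ) + 1) ^ 2) (Real.pi ^ 2 / 4) := by
  have hz := hasSum_zeta_two
  have h2 : HasSum (fun n : ℕ => (1 + (-1 : ℝ) ^ n) / (n : ℝ) ^ 2) (Real.pi ^ 2 / 12) := by
    have := (mul_right_injective₀ (two_ne_zero' ℕ)).hasSum_iff
      (f := fun n : ℕ => (1 + (-1 : ℝ) ^ n) / (n : ℝ) ^ 2) (a := Real.pi ^ 2 / 12) ?_
    · rw [← this]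
      convert! hz.div_const 2 using 1
      · ext n
        simp only [Function.comp, pow_mul]
        push_cast
        by_cases hn : (n : ℝ) = 0
        · simp [hn]
        · field_simp
          norm_num
      · ring
    · intro n hn
      have : Odd n := by
        rw [← Nat.not_even_iff_odd]
        rintro ⟨k, hk⟩
        exact hn ⟨k, by simp only; omega⟩
      simp [this.neg_one_pow]
  have h3 := (hz.mul_left 2).sub h2
  rw [← hasSum_nat_add_iff' 1] at h3
  convert! h3 using 1
  · ext n
    push_cast
    ring
  · simp
    ring

lemma summable_one_div_add_one_cube : Summable fun n : ℕ => 1 / ((n : ℝ) + 1) ^ 3 := by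
  have := (summable_nat_add_iff 1).mpr
    (Real.summable_one_div_nat_pow.mpr (show 1 < 3 by norm_num))
  simpa using! this

lemma tsum_alternating_fst_mul_add_sq :
    ∑' p : ℕ × ℕ, (-1 : ℝ) ^ p.1 / (((p.1 : ℝ) + 1) * ((p.1 : ℝ) + p.2 + 2) ^ 2) =
      Real.pi ^ 2 / 4 * Real.log 2 - ∑' n : ℕ, 1 / ((n : ℝ) + 1) ^ 3 := by
  have hF := summable_alternating_mul_mul_add
  have hrow := hF.hasSum.prod_fiberwise hasSum_alternating_mul_mul_add_row
  have hd := hrow.sub hasSum_alternating_altHarmonic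
  have hv := (hasSum_one_add_alternating_div_sq.mul_right (Real.log 2)).sub
    summable_one_div_add_one_cube.hasSum
  rw [← (Equiv.prodComm ℕ ℕ).tsum_eq, ← hv.tsum_eq]
  have h1 := hF.tsum_sub summable_alternating_mul_add_sq
  rw [← hd.tsum_eq] at h1
  refine Eq.trans (tsum_congr fun p => ?_) (h1.trans (tsum_congr fun i => ?_))
  · simp only [Equiv.prodComm_apply, Prod.fst_swap, Prod.snd_swap]
    have : (p.1 : ℝ) + p.2 + 2 ≠ 0 := by positivity
    rw [add_comm (p.2 : ℝ) p.1]
    field_simp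
    ring
  · rw [altHarmonic_succ]
    have h2 : (-1 : ℝ) ^ i * (-1) ^ i = 1 := by rw [← mul_pow]; simp
    field_simp
    linear_combination (-1 : ℝ) * h2

/-- Pairs of positive integers `k₁ < k₂` are parametrised by `(k₁ - 1, k₂ - k₁ - 1)`. -/
def prodEquivPosLt : ℕ × ℕ ≃ {p : ℕ × ℕ // 0 < p.1 ∧ p.1 < p.2} where
  toFun q := ⟨(q.1 + 1, q.1 + q.2 + 2), by constructor <;> simp only <;> omega⟩
  invFun p := (p.1.1 - 1, p.1.2 - p.1.1 - 1)
  left_inv q := by ext <;> simp only <;> omega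
  right_inv := by
    rintro ⟨⟨a, b⟩, h1, h2⟩
    ext <;> simp only at * <;> omega

theorem alternating_mzv_one_bar_two :
    (Summable fun p : {p : ℕ × ℕ // 0 < p.1 ∧ p.1 < p.2} =>
      |(-1 : ℝ) ^ p.1.1 / ((p.1.1 : ℝ) * (p.1.2 : ℝ) ^ 2)|) ∧
    (∑' p : {p : ℕ × ℕ // 0 < p.1 ∧ p.1 < p.2},
        (-1 : ℝ) ^ p.1.1 / ((p.1.1 : ℝ) * (p.1.2 : ℝ) ^ 2))
      = (∑' n : ℕ, 1 / ((n : ℝ) + 1) ^ 3) - Real.pi ^ 2 / 4 * Real.log 2 := by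
  constructor
  · rw [← prodEquivPosLt.summable_iff]
    refine summable_inv_mul_add_sq.congr fun p => ?_
    simp only [Function.comp, prodEquivPosLt, Equiv.coe_fn_mk]
    push_cast
    rw [abs_div, abs_pow, abs_neg, abs_one, one_pow, abs_of_nonneg (by positivity)]
  · rw [← prodEquivPosLt.tsum_eq, ← neg_sub, ← tsum_alternating_fst_mul_add_sq, ← tsum_neg]
    refine tsum_congr fun p => ?_
    simp only [prodEquivPosLt, Equiv.coe_fn_mk]
    push_cast
    rw [pow_succ]
    ring
end
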